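/- The wheel graph W₅ is not a grounded square-L graph: there do not exist functions a, h from the six vertices of W₅ to ℝ, with h v > 0 for every vertex v, such that for all distinct vertices u, v the shapes Λ(a u, h u, h u) and Λ(a v, h v, h v) have nonempty intersection if and only if u and v are adjacent in W₅. -/

import Mathlib

/-- The grounded L-shape with foot `(a, 0)`, height `h` and horizontal arm length `w`:
`({a} × [0, h]) ∪ ([a, a + w] × {h})`. -/
def Lshape (a h w : ℝ) : Set (ℝ × ℝ) :=
  ({a} ×ˢ Set.Icc 0 h) ∪ (Set.Icc a (a + w) ×ˢ {h})

/-- The wheel graph `W₅`: vertex `0` is the hub, adjacent to all of `1,…,5`, and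
`1,2,3,4,5` form a 5-cycle. -/
def W5 : SimpleGraph (Fin 6) :=
  SimpleGraph.fromRel (fun u v =>
    u = 0 ∨ (u = 1 ∧ v = 2) ∨ (u = 2 ∧ v = 3) ∨ (u = 3 ∧ v = 4) ∨
      (u = 4 ∧ v = 5) ∨ (u = 5 ∧ v = 1))


/-- Explicit intersection criterion. -/
def SAdj (p q : ℝ × ℝ) : Prop :=
  p.1 = q.1 ∨ (p.1 < q.1 ∧ p.2 ≤ q.2 ∧ q.1 ≤ p.1 + p.2) ∨
    (q.1 < p.1 ∧ q.2 ≤ p.2 ∧ p.1 ≤ q.1 + q.2)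

theorem sadj_iff (a h b k : ℝ) (hh : 0 < h) (hk : 0 < k) :
    (Lshape a h h ∩ Lshape b k k).Nonempty ↔ SAdj (a, h) (b, k) := by
  unfold SAdj
  constructor
  · rintro ⟨⟨x, y⟩, h1, h2⟩
    simp only [Lshape, Set.mem_union, Set.mem_prod, Set.mem_singleton_iff, Set.mem_Icc] at h1 h2
    dsimp only
    rcases lt_trichotomy a b with hab | hab | hab
    · right; left
      rcases h1 with ⟨h1, h3, h4⟩ | ⟨⟨h1, h3⟩, h4⟩ <;>
      rcases h2 with ⟨h2, h5, h6⟩ | ⟨⟨h2, h5⟩, h6⟩ <;>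
      refine ⟨hab, ?_, ?_⟩ <;> linarith
    · left; exact hab
    · right; right
      rcases h1 with ⟨h1, h3, h4⟩ | ⟨⟨h1, h3⟩, h4⟩ <;>
      rcases h2 with ⟨h2, h5, h6⟩ | ⟨⟨h2, h5⟩, h6⟩ <;>
      refine ⟨hab, ?_, ?_⟩ <;> linarith
  · dsimp only
    rintro (e | ⟨e1, e2, e3⟩ | ⟨e1, e2, e3⟩)
    · refine ⟨(a, 0), Or.inl ⟨rfl, le_refl _, hh.le⟩, Or.inl ⟨e, le_refl _, hk.le⟩⟩
    · exact ⟨(b, h), Or.inr ⟨⟨e1.le, e3⟩, rfl⟩, Or.inl ⟨rfl, hh.le, e2⟩⟩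
    · exact ⟨(a, k), Or.inl ⟨rfl, hk.le, e2⟩, Or.inr ⟨⟨e1.le, e3⟩, rfl⟩⟩

/-- Left of the hub. -/
def IsL (x p : ℝ × ℝ) : Prop := p.1 ≤ x.1 ∧ p.2 ≤ x.2 ∧ x.1 ≤ p.1 + p.2

/-- Right of the hub. -/
def IsR (x p : ℝ × ℝ) : Prop := x.1 ≤ p.1 ∧ x.2 ≤ p.2 ∧ p.1 ≤ x.1 + x.2

/-- Comparability in the dominance order. -/
def PAdj (p q : ℝ × ℝ) : Prop :=
  p.1 = q.1 ∨ (p.1 < q.1 ∧ p.2 ≤ q.2) ∨ (q.1 < p.1 ∧ q.2 ≤ p.2)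

theorem isL_or_isR {x p : ℝ × ℝ} (hx : 0 < x.2) (hp : 0 < p.2) (h : SAdj x p) :
    IsL x p ∨ IsR x p := by
  unfold SAdj at h
  unfold IsL IsR
  rcases h with h | h | h
  · rcases le_total p.2 x.2 with h' | h'
    · left; refine ⟨h.ge, h', by linarith⟩
    · right; refine ⟨h.le, h', by linarith⟩
  · right; exact ⟨h.1.le, h.2⟩
  · left; exact ⟨h.1.le, h.2⟩

theorem sadj_LL {x p q : ℝ × ℝ} (hp : IsL x p) (hq : IsL x q) : SAdj p q ↔ PAdj p q := by
  unfold SAdj PAdj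
  have h1 : q.1 ≤ p.1 + p.2 := hq.1.trans hp.2.2
  have h2 : p.1 ≤ q.1 + q.2 := hp.1.trans hq.2.2
  tauto

theorem sadj_RR {x p q : ℝ × ℝ} (hp : IsR x p) (hq : IsR x q) : SAdj p q ↔ PAdj p q := by
  unfold SAdj PAdj
  obtain ⟨a1, a2, a3⟩ := hp
  obtain ⟨b1, b2, b3⟩ := hq
  have h1 : q.1 ≤ p.1 + p.2 := by linarith
  have h2 : p.1 ≤ q.1 + q.2 := by linarith
  tauto

theorem sadj_LR {x p q : ℝ × ℝ} (h0 : 0 < p.2) (hp : IsL x p) (hq : IsR x q) :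
    SAdj p q ↔ q.1 ≤ p.1 + p.2 := by
  unfold SAdj
  obtain ⟨a1, a2, a3⟩ := hp
  obtain ⟨b1, b2, b3⟩ := hq
  constructor
  · rintro (h | h | h)
    · linarith
    · exact h.2.2
    · linarith [h.1]
  · intro h
    rcases (a1.trans b1).eq_or_lt with h' | h'
    · left; exact h'
    · right; left; exact ⟨h', a2.trans b2, h⟩

theorem sadj_comm {p q : ℝ × ℝ} : SAdj p q ↔ SAdj q p := by
  unfold SAdj
  rw [eq_comm]
  tauto

/-- An induced 5-cycle whose members all meet the hub. -/
structure Cyc (x p1 p2 p3 p4 p5 : ℝ × ℝ) : Prop where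
  c1 : 0 < p1.2
  c2 : 0 < p2.2
  c3 : 0 < p3.2
  c4 : 0 < p4.2
  c5 : 0 < p5.2
  h12 : SAdj p1 p2
  h23 : SAdj p2 p3
  h34 : SAdj p3 p4
  h45 : SAdj p4 p5
  h51 : SAdj p5 p1
  n13 : ¬ SAdj p1 p3
  n24 : ¬ SAdj p2 p4
  n35 : ¬ SAdj p3 p5
  n41 : ¬ SAdj p4 p1
  n52 : ¬ SAdj p5 p2

theorem Cyc.rot {x p1 p2 p3 p4 p5 : ℝ × ℝ} (h : Cyc x p1 p2 p3 p4 p5) :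
    Cyc x p2 p3 p4 p5 p1 :=
  ⟨h.c2, h.c3, h.c4, h.c5, h.c1, h.h23, h.h34, h.h45, h.h51, h.h12,
    h.n24, h.n35, h.n41, h.n52, h.n13⟩

theorem cross {x u u' v v' : ℝ × ℝ} (c : 0 < u.2) (c' : 0 < u'.2)
    (hu : IsL x u) (hu' : IsL x u') (hv : IsR x v) (hv' : IsR x v')
    (h1 : SAdj u v) (h2 : SAdj u' v') (n1 : ¬ SAdj u v') (n2 : ¬ SAdj u' v) : False := by
  rw [sadj_LR c hu hv] at h1
  rw [sadj_LR c' hu' hv'] at h2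
  rw [sadj_LR c hu hv'] at n1
  rw [sadj_LR c' hu' hv] at n2
  linarith

theorem pat1 {x p1 p2 p3 p4 p5 : ℝ × ℝ} (h : Cyc x p1 p2 p3 p4 p5)
    (l1 : IsL x p1) (l2 : IsL x p2) (r3 : IsR x p3) (r5 : IsR x p5) : False :=
  cross h.c1 h.c2 l1 l2 r5 r3 (sadj_comm.1 h.h51) h.h23 h.n13 (fun e => h.n52 (sadj_comm.1 e))

theorem pat2 {x p1 p2 p3 p4 p5 : ℝ × ℝ} (h : Cyc x p1 p2 p3 p4 p5)
    (l1 : IsL x p1) (l3 : IsL x p3) (r4 : IsR x p4) (r5 : IsR x p5) : False :=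
  cross h.c1 h.c3 l1 l3 r5 r4 (sadj_comm.1 h.h51) h.h34 (fun e => h.n41 (sadj_comm.1 e)) h.n35

theorem perm5 {p1 p2 p3 p4 p5 : ℝ × ℝ}
    (h12 : PAdj p1 p2) (h23 : PAdj p2 p3) (h34 : PAdj p3 p4) (h45 : PAdj p4 p5)
    (h51 : PAdj p5 p1) (n13 : ¬ PAdj p1 p3) (n24 : ¬ PAdj p2 p4) (n35 : ¬ PAdj p3 p5)
    (n41 : ¬ PAdj p4 p1) (n52 : ¬ PAdj p5 p2) : False := by
  unfold PAdj at *
  grind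

theorem allL {x p1 p2 p3 p4 p5 : ℝ × ℝ} (h : Cyc x p1 p2 p3 p4 p5)
    (l1 : IsL x p1) (l2 : IsL x p2) (l3 : IsL x p3) (l4 : IsL x p4) (l5 : IsL x p5) : False :=
  perm5 ((sadj_LL l1 l2).1 h.h12) ((sadj_LL l2 l3).1 h.h23) ((sadj_LL l3 l4).1 h.h34)
    ((sadj_LL l4 l5).1 h.h45) ((sadj_LL l5 l1).1 h.h51)
    (fun e => h.n13 ((sadj_LL l1 l3).2 e)) (fun e => h.n24 ((sadj_LL l2 l4).2 e))
    (fun e => h.n35 ((sadj_LL l3 l5).2 e)) (fun e => h.n41 ((sadj_LL l4 l1).2 e))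
    (fun e => h.n52 ((sadj_LL l5 l2).2 e))

theorem allR {x p1 p2 p3 p4 p5 : ℝ × ℝ} (h : Cyc x p1 p2 p3 p4 p5)
    (l1 : IsR x p1) (l2 : IsR x p2) (l3 : IsR x p3) (l4 : IsR x p4) (l5 : IsR x p5) : False :=
  perm5 ((sadj_RR l1 l2).1 h.h12) ((sadj_RR l2 l3).1 h.h23) ((sadj_RR l3 l4).1 h.h34)
    ((sadj_RR l4 l5).1 h.h45) ((sadj_RR l5 l1).1 h.h51)
    (fun e => h.n13 ((sadj_RR l1 l3).2 e)) (fun e => h.n24 ((sadj_RR l2 l4).2 e))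
    (fun e => h.n35 ((sadj_RR l3 l5).2 e)) (fun e => h.n41 ((sadj_RR l4 l1).2 e))
    (fun e => h.n52 ((sadj_RR l5 l2).2 e))

theorem oneL {x p1 p2 p3 p4 p5 : ℝ × ℝ} (h : Cyc x p1 p2 p3 p4 p5)
    (l1 : IsL x p1) (l2 : IsR x p2) (l3 : IsR x p3) (l4 : IsR x p4) (l5 : IsR x p5) : False := by
  have h12 := (sadj_LR h.c1 l1 l2).1 h.h12
  have h15 := (sadj_LR h.c1 l1 l5).1 (sadj_comm.1 h.h51)
  have n13 := mt (sadj_LR h.c1 l1 l3).2 h.n13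
  have n14 := mt (sadj_LR h.c1 l1 l4).2 (mt sadj_comm.1 h.n41)
  have h23 := (sadj_RR l2 l3).1 h.h23
  have h34 := (sadj_RR l3 l4).1 h.h34
  have h45 := (sadj_RR l4 l5).1 h.h45
  have n24 := mt (sadj_RR l2 l4).2 h.n24
  have n35 := mt (sadj_RR l3 l5).2 h.n35
  have n52 := mt (sadj_RR l5 l2).2 h.n52
  clear l1 l2 l3 l4 l5 h
  unfold PAdj at *
  grind

theorem oneR {x p1 p2 p3 p4 p5 : ℝ × ℝ} (h : Cyc x p1 p2 p3 p4 p5)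
    (l1 : IsR x p1) (l2 : IsL x p2) (l3 : IsL x p3) (l4 : IsL x p4) (l5 : IsL x p5) : False := by
  have h12 := (sadj_LR h.c2 l2 l1).1 (sadj_comm.1 h.h12)
  have h15 := (sadj_LR h.c5 l5 l1).1 h.h51
  have n13 := mt (sadj_LR h.c3 l3 l1).2 (mt sadj_comm.1 h.n13)
  have n14 := mt (sadj_LR h.c4 l4 l1).2 h.n41
  have h23 := (sadj_LL l2 l3).1 h.h23
  have h34 := (sadj_LL l3 l4).1 h.h34
  have h45 := (sadj_LL l4 l5).1 h.h45
  have n24 := mt (sadj_LL l2 l4).2 h.n24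
  have n35 := mt (sadj_LL l3 l5).2 h.n35
  have n52 := mt (sadj_LL l5 l2).2 h.n52
  clear l1 l2 l3 l4 l5 h
  unfold PAdj at *
  grind

theorem noCyc {x p1 p2 p3 p4 p5 : ℝ × ℝ} (h : Cyc x p1 p2 p3 p4 p5)
    (o1 : IsL x p1 ∨ IsR x p1) (o2 : IsL x p2 ∨ IsR x p2) (o3 : IsL x p3 ∨ IsR x p3)
    (o4 : IsL x p4 ∨ IsR x p4) (o5 : IsL x p5 ∨ IsR x p5) : False := by
  have r1 := h.rot
  have r2 := r1.rot
  have r3 := r2.rot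
  have r4 := r3.rot
  rcases o1 with o1 | o1 <;> rcases o2 with o2 | o2 <;> rcases o3 with o3 | o3 <;>
  rcases o4 with o4 | o4 <;> rcases o5 with o5 | o5 <;>
  first
  | exact allL h o1 o2 o3 o4 o5
  | exact allR h o1 o2 o3 o4 o5
  | exact pat1 h o1 o2 o3 o5
  | exact pat1 r1 o2 o3 o4 o1
  | exact pat1 r2 o3 o4 o5 o2
  | exact pat1 r3 o4 o5 o1 o3
  | exact pat1 r4 o5 o1 o2 o4
  | exact pat2 h o1 o3 o4 o5
  | exact pat2 r1 o2 o4 o5 o1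
  | exact pat2 r2 o3 o5 o1 o2
  | exact pat2 r3 o4 o1 o2 o3
  | exact pat2 r4 o5 o2 o3 o4
  | exact oneL h o1 o2 o3 o4 o5
  | exact oneL r1 o2 o3 o4 o5 o1
  | exact oneL r2 o3 o4 o5 o1 o2
  | exact oneL r3 o4 o5 o1 o2 o3
  | exact oneL r4 o5 o1 o2 o3 o4
  | exact oneR h o1 o2 o3 o4 o5
  | exact oneR r1 o2 o3 o4 o5 o1
  | exact oneR r2 o3 o4 o5 o1 o2
  | exact oneR r3 o4 o5 o1 o2 o3
  | exact oneR r4 o5 o1 o2 o3 o4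

theorem W5_not_grounded_square_L_graph :
    ¬ ∃ a h : Fin 6 → ℝ,
      (∀ v, 0 < h v) ∧
      ∀ u v : Fin 6, u ≠ v →
        ((Lshape (a u) (h u) (h u) ∩ Lshape (a v) (h v) (h v)).Nonempty ↔ W5.Adj u v) := by
  rintro ⟨a, h, hp, H⟩
  have K : ∀ u v : Fin 6, u ≠ v → (SAdj (a u, h u) (a v, h v) ↔ W5.Adj u v) := by
    intro u v huv
    rw [← sadj_iff _ _ _ _ (hp u) (hp v)]
    exact H u v huv
  have hub : ∀ v : Fin 6, v ≠ 0 →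
      IsL (a 0, h 0) (a v, h v) ∨ IsR (a 0, h 0) (a v, h v) := by
    intro v hv
    refine isL_or_isR (hp 0) (hp v) ((K 0 v hv.symm).2 ?_)
    simp [W5, hv.symm]
  have C : Cyc (a 0, h 0) (a 1, h 1) (a 2, h 2) (a 3, h 3) (a 4, h 4) (a 5, h 5) := by
    refine ⟨hp 1, hp 2, hp 3, hp 4, hp 5, ?_, ?_, ?_, ?_, ?_, ?_, ?_, ?_, ?_, ?_⟩ <;>
    rw [K _ _ (by decide)] <;> simp [W5]
  exact noCyc C (hub 1 (by decide)) (hub 2 (by decide)) (hub 3 (by decide)) (hub 4 (by decide))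
    (hub 5 (by decide))
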